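/- arXiv:1310.7993 — 2 statements merged into one kernel-verified Lean document; each statement's English description precedes it below -/
import Mathlib

section
/- Let E be a nontrivial finite-dimensional real inner product space, K ∈ ℝ, N < 0, and let f : E → ℝ be continuously differentiable such that for all x ≠ z in E with d := ‖x − z‖ (satisfying d < π√(N/K) when K < 0) one has f_N(z) ≥ 𝔠_{K/N}(d)·f_N(x) − (𝔰_{K/N}(d)/(N d))·f_N(x)·⟨∇f(x), z − x⟩. Let ξ : [0,T) → E be continuous, differentiable on (0,T), with ξ'(t) = −∇f(ξ(t)) for all t ∈ (0,T). Then for every z ∈ E and every t ∈ (0,T) (with ‖ξ(t) − z‖ < π√(N/K) when K < 0), the function s ↦ 𝔰_{K/N}(‖ξ(s) − z‖/2)² is differentiable at t and its derivative D satisfies D + K·𝔰_{K/N}(‖ξ(t) − z‖/2)² ≤ (N/2)·(1 − f_N(z)/f_N(ξ(t))). -/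
open Real
open scoped RealInnerProductSpace

/-- The comparison function `𝔰_κ`. -/
noncomputable def sk (κ θ : ℝ) : ℝ :=
  if 0 < κ then Real.sin (Real.sqrt κ * θ) / Real.sqrt κ
  else if κ = 0 then θ
  else Real.sinh (Real.sqrt (-κ) * θ) / Real.sqrt (-κ)

/-- The comparison function `𝔠_κ`. -/
noncomputable def ck (κ θ : ℝ) : ℝ :=
  if 0 < κ then Real.cos (Real.sqrt κ * θ)
  else if κ = 0 then 1
  else Real.cosh (Real.sqrt (-κ) * θ)

/-- The distortion coefficient `σ_κ^{(t)}(θ)`. -/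
noncomputable def sg (κ t θ : ℝ) : ℝ := if θ = 0 then t else sk κ (t * θ) / sk κ θ

theorem sk_hasDerivAt (κ u : ℝ) : HasDerivAt (sk κ) (ck κ u) u := by
  unfold sk ck
  split_ifs with h1 h2
  · have h : Real.sqrt κ ≠ 0 := (Real.sqrt_pos.2 h1).ne'
    have := (((hasDerivAt_id u).const_mul (Real.sqrt κ)).sin).div_const (Real.sqrt κ)
    refine this.congr_deriv ?_
    simp only [id]
    field_simp
  · exact hasDerivAt_id u
  · have h3 : κ < 0 := lt_of_le_of_ne (not_lt.1 h1) h2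
    have h : Real.sqrt (-κ) ≠ 0 := (Real.sqrt_pos.2 (by linarith)).ne'
    have := (((hasDerivAt_id u).const_mul (Real.sqrt (-κ))).sinh).div_const (Real.sqrt (-κ))
    refine this.congr_deriv ?_
    simp only [id]
    field_simp

theorem sk_zero' (κ : ℝ) : sk κ 0 = 0 := by
  unfold sk
  split_ifs <;> simp

theorem sk_double (κ u : ℝ) : sk κ (2 * u) = 2 * sk κ u * ck κ u := by
  unfold sk ck
  split_ifs with h1 h2
  · rw [show Real.sqrt κ * (2 * u) = 2 * (Real.sqrt κ * u) by ring, Real.sin_two_mul]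
    ring
  · ring
  · rw [show Real.sqrt (-κ) * (2 * u) = 2 * (Real.sqrt (-κ) * u) by ring, Real.sinh_two_mul]
    ring

theorem ck_double (κ u : ℝ) : κ * sk κ u ^ 2 = (1 - ck κ (2 * u)) / 2 := by
  unfold sk ck
  split_ifs with h1 h2
  · rw [show Real.sqrt κ * (2 * u) = 2 * (Real.sqrt κ * u) by ring, Real.cos_two_mul, div_pow,
      Real.sq_sqrt h1.le, Real.sin_sq]
    field_simp
    ring
  · simp [h2]
  · have h3 : κ < 0 := lt_of_le_of_ne (not_lt.1 h1) h2
    rw [show Real.sqrt (-κ) * (2 * u) = 2 * (Real.sqrt (-κ) * u) by ring, Real.cosh_two_mul,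
      div_pow, Real.sq_sqrt (by linarith), Real.cosh_sq]
    field_simp
    ring

theorem sk_sq_hasDerivAt (κ d : ℝ) :
    HasDerivAt (fun u => sk κ (u / 2) ^ 2) (sk κ d / 2) d := by
  have h1 : HasDerivAt (fun u : ℝ => u / 2) (1 / 2) d := (hasDerivAt_id d).div_const 2
  have h2 := ((sk_hasDerivAt κ (d / 2)).comp d h1).pow 2
  refine h2.congr_deriv ?_
  have h3 := sk_double κ (d / 2)
  rw [show 2 * (d / 2) = d by ring] at h3
  rw [h3]
  simp only [Function.comp]
  push_cast
  ring

theorem stmt_1 {E : Type*} [NormedAddCommGroup E] [InnerProductSpace ℝ E]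
    [FiniteDimensional ℝ E] [Nontrivial E]
    (f : E → ℝ) (hf : ContDiff ℝ 1 f) (K N : ℝ) (hN : N < 0)
    (hconv : ∀ x z : E, x ≠ z → (K < 0 → ‖x - z‖ < π * Real.sqrt (N / K)) →
      ck (K / N) ‖x - z‖ * Real.exp (-f x / N)
        - sk (K / N) ‖x - z‖ / (N * ‖x - z‖) * Real.exp (-f x / N)
            * ⟪gradient f x, z - x⟫
        ≤ Real.exp (-f z / N))
    (T : ℝ) (ξ : ℝ → E)
    (hξc : ContinuousOn ξ (Set.Ico 0 T))
    (hξ' : ∀ t ∈ Set.Ioo (0:ℝ) T, HasDerivAt ξ (-(gradient f (ξ t))) t) :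
    ∀ z : E, ∀ t ∈ Set.Ioo (0:ℝ) T, (K < 0 → ‖ξ t - z‖ < π * Real.sqrt (N / K)) →
      ∃ D : ℝ, HasDerivAt (fun s => sk (K / N) (‖ξ s - z‖ / 2) ^ 2) D t ∧
        D + K * sk (K / N) (‖ξ t - z‖ / 2) ^ 2
          ≤ N / 2 * (1 - Real.exp (-f z / N) / Real.exp (-f (ξ t) / N)) := by
  intro z t ht hd
  have hξt := hξ' t ht
  have hsub : HasDerivAt (fun s => ξ s - z) (-(gradient f (ξ t))) t := hξt.sub_const z
  by_cases hz : ξ t = z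
  · refine ⟨0, ?_, ?_⟩
    · have h0 := sk_sq_hasDerivAt (K / N) 0
      rw [sk_zero', zero_div, hasDerivAt_iff_isLittleO] at h0
      rw [hasDerivAt_iff_isLittleO]
      have hT : Filter.Tendsto (fun s => ‖ξ s - z‖) (nhds t) (nhds 0) := by
        have := hsub.continuousAt.norm.tendsto
        simpa [hz] using this
      have h1 := h0.comp_tendsto hT
      have h2 : (fun s => ‖ξ s - z‖) =O[nhds t] (fun s => s - t) := by
        have := hξt.isBigO_sub
        rw [hz] at this
        exact this.norm_left
      have h3 : ((fun x' : ℝ => x' - 0) ∘ fun s => ‖ξ s - z‖) =O[nhds t] (fun s => s - t) := by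
        simpa [Function.comp_def] using h2
      have h4 := h1.trans_isBigO h3
      simpa [Function.comp_def, hz] using h4
    · simp [hz, sk_zero', (Real.exp_pos _).ne']
  · have hne : ξ t - z ≠ 0 := sub_ne_zero.2 hz
    have hdpos : 0 < ‖ξ t - z‖ := norm_pos_iff.2 hne
    have hnorm : HasDerivAt (fun s => ‖ξ s - z‖)
        (⟪gradient f (ξ t), z - ξ t⟫ / ‖ξ t - z‖) t := by
      have h1 := (hsub.norm_sq).sqrt (by positivity)
      simp only [Real.sqrt_sq (norm_nonneg _)] at h1
      refine h1.congr_deriv ?_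
      rw [inner_neg_right, real_inner_comm, ← neg_sub (ξ t) z, inner_neg_right]
      field_simp
    have hD := HasDerivAt.comp t (sk_sq_hasDerivAt (K / N) ‖ξ t - z‖) hnorm
    refine ⟨_, hD, ?_⟩
    have hc := hconv (ξ t) z hz hd
    have hck := ck_double (K / N) (‖ξ t - z‖ / 2)
    rw [show 2 * (‖ξ t - z‖ / 2) = ‖ξ t - z‖ by ring] at hck
    have hK : K * sk (K / N) (‖ξ t - z‖ / 2) ^ 2 = N / 2 * (1 - ck (K / N) ‖ξ t - z‖) := by
      have : K = N * (K / N) := by field_simp [hN.ne]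
      calc _ = N * (K / N * sk (K / N) (‖ξ t - z‖ / 2) ^ 2) := by
            rw [← mul_assoc, ← this]
        _ = _ := by rw [hck]; ring
    rw [hK]
    generalize ck (K / N) ‖ξ t - z‖ = c at *
    generalize sk (K / N) ‖ξ t - z‖ = σ at *
    generalize ⟪gradient f (ξ t), z - ξ t⟫ = G at *
    generalize ‖ξ t - z‖ = d at *
    have hx := Real.exp_pos (-f (ξ t) / N)
    generalize Real.exp (-f (ξ t) / N) = X at *
    generalize Real.exp (-f z / N) = Z at *
    have hr : c - σ / (N * d) * G ≤ Z / X := by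
      rw [le_div_iff₀ hx]
      linarith
    have h5 := mul_le_mul_of_nonneg_left hr (by linarith : 0 ≤ -N / 2)
    have h6 : -N / 2 * (c - σ / (N * d) * G) = -N / 2 * c + σ / 2 * (G / d) := by
      have := hN.ne
      field_simp
      ring
    linarith
end

section
/- Let K ∈ ℝ, N < 0, t ∈ (0,1], and θ > 0 with θ < π√(N/K) when K < 0. Then τ_{K,N}^{(t)}(θ) ≤ σ_{K/N}^{(t)}(θ), where τ_{K,N}^{(t)}(θ) := t^{1/N}·(σ_{K/(N−1)}^{(t)}(θ))^{(N−1)/N}; equivalently, t·(σ_{K/(N−1)}^{(t)}(θ))^{N−1} ≥ (σ_{K/N}^{(t)}(θ))^{N}. -/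
open Real

lemma sk_tendsto (κ θ : ℝ) :
    Filter.Tendsto (fun n : ℕ => θ * ∏ j ∈ Finset.range n,
      (1 - κ * θ ^ 2 / (π ^ 2 * ((j : ℝ) + 1) ^ 2))) Filter.atTop (nhds (sk κ θ)) := by
  have hpi : π ≠ 0 := Real.pi_ne_zero
  unfold sk
  split_ifs with h1 h2
  · have hs : √κ ≠ 0 := (Real.sqrt_pos.2 h1).ne'
    have h := (Real.tendsto_euler_sin_prod (√κ * θ / π)).div_const (√κ)
    have e : π * (√κ * θ / π) = √κ * θ := by field_simp
    rw [e] at h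
    refine h.congr fun n => ?_
    rw [div_eq_iff hs]
    have : ∀ j : ℕ, (1 - (√κ * θ / π) ^ 2 / ((j : ℝ) + 1) ^ 2)
        = (1 - κ * θ ^ 2 / (π ^ 2 * ((j : ℝ) + 1) ^ 2)) := by
      intro j
      rw [div_pow, mul_pow, Real.sq_sqrt h1.le, div_div]
    simp only [this]
    ring
  · subst h2
    simp
  · have hk : 0 < -κ := by
      rcases lt_trichotomy κ 0 with h | h | h
      · linarith
      · exact absurd h h2
      · exact absurd h h1
    have hs : √(-κ) ≠ 0 := (Real.sqrt_pos.2 hk).ne'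
    have h := (Complex.tendsto_euler_sin_prod (((√(-κ) * θ / π : ℝ) : ℂ) * Complex.I)).mul_const
      (-Complex.I)
    have e : (π : ℂ) * (((√(-κ) * θ / π : ℝ) : ℂ) * Complex.I)
        = ((√(-κ) * θ : ℝ) : ℂ) * Complex.I := by
      rw [← mul_assoc, ← Complex.ofReal_mul]
      congr 2
      field_simp
    rw [e, Complex.sin_mul_I] at h
    have e2 : Complex.sinh ((√(-κ) * θ : ℝ) : ℂ) * Complex.I * -Complex.I
        = ((Real.sinh (√(-κ) * θ) : ℝ) : ℂ) := by
      rw [Complex.ofReal_sinh]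
      linear_combination (-Complex.sinh ((√(-κ) * θ : ℝ) : ℂ)) * Complex.I_mul_I
    rw [e2] at h
    have h' := ((Complex.continuous_re.tendsto _).comp h).div_const (√(-κ))
    rw [Complex.ofReal_re] at h'
    refine h'.congr fun n => ?_
    have : ∀ j : ℕ, (1 - (((√(-κ) * θ / π : ℝ) : ℂ) * Complex.I) ^ 2 / ((j : ℂ) + 1) ^ 2)
        = ((1 - κ * θ ^ 2 / (π ^ 2 * ((j : ℝ) + 1) ^ 2) : ℝ) : ℂ) := by
      intro j
      have : (((√(-κ) * θ / π : ℝ) : ℂ) * Complex.I) ^ 2 = ((κ * θ ^ 2 / π ^ 2 : ℝ) : ℂ) := by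
        rw [mul_pow, Complex.I_sq, ← Complex.ofReal_pow, div_pow, mul_pow, Real.sq_sqrt hk.le]
        push_cast
        ring
      rw [this, ← div_div]
      push_cast
      ring
    simp only [Function.comp, this]
    rw [← Complex.ofReal_prod]
    have e3 : ∀ P : ℝ, ((√(-κ) * θ : ℝ) : ℂ) * Complex.I * (P : ℂ) * -Complex.I
        = ((√(-κ) * θ * P : ℝ) : ℂ) := by
      intro P
      push_cast
      linear_combination (-(√(-κ) : ℂ) * θ * P) * Complex.I_mul_I
    rw [e3, Complex.ofReal_re, div_eq_iff hs]
    ring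

lemma factor_le (s l u : ℝ) (hs0 : 0 < s) (hs1 : s ≤ 1) (hl0 : 0 < l) (hl1 : l < 1)
    (hu : u < 1) :
    (1 - s * (l * u)) / (1 - l * u) ≤ ((1 - s * u) / (1 - u)) ^ l := by
  have key : ∀ c : ℝ, 0 ≤ c → c ≤ 1 → 0 < 1 - c * u := by
    intro c h0 h1
    rcases le_total u 0 with h | h
    · nlinarith
    · nlinarith
  have p1 : 0 < 1 - u := by linarith
  have p2 := key s hs0.le hs1
  have p3 := key l hl0.le hl1.le
  have p4 := key (s + l - l * s) (by nlinarith) (by nlinarith)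
  have hb : ((1 - u) / (1 - s * u)) ^ l ≤ (1 - (s + l - l * s) * u) / (1 - s * u) := by
    have h := rpow_one_add_le_one_add_mul_self (s := (1 - u) / (1 - s * u) - 1) (p := l)
      (by have := div_pos p1 p2; linarith) hl0.le hl1.le
    rw [add_sub_cancel] at h
    refine h.trans (le_of_eq ?_)
    have p2n := p2.ne'
    rw [eq_div_iff p2n, div_sub_one p2n, add_mul, mul_assoc, div_mul_cancel₀ _ p2n]
    ring
  have hinv : ((1 - s * u) / (1 - u)) ^ l = (((1 - u) / (1 - s * u)) ^ l)⁻¹ := by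
    rw [← Real.inv_rpow (div_pos p1 p2).le, inv_div]
  rw [hinv]
  refine le_trans ?_ (inv_anti₀ (Real.rpow_pos_of_pos (div_pos p1 p2) l) hb)
  rw [inv_div, div_le_div_iff₀ p3 p4]
  have : 0 ≤ s * l * u ^ 2 * ((1 - s) * (1 - l)) := by
    have := sub_nonneg.2 hs1
    have := sub_nonneg.2 hl1.le
    positivity
  nlinarith

lemma sg_tendsto (κ t θ : ℝ) (ht : 0 < t) (hθ : 0 < θ) (h : sk κ θ ≠ 0) :
    Filter.Tendsto (fun n : ℕ => ∏ j ∈ Finset.range n,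
      ((1 - t ^ 2 * (κ * θ ^ 2 / (π ^ 2 * ((j : ℝ) + 1) ^ 2))) /
        (1 - κ * θ ^ 2 / (π ^ 2 * ((j : ℝ) + 1) ^ 2)))) Filter.atTop (nhds (sg κ t θ / t)) := by
  have h1 := ((sk_tendsto κ (t * θ)).div (sk_tendsto κ θ) h).div_const t
  rw [sg, if_neg hθ.ne']
  refine h1.congr fun n => ?_
  rw [Finset.prod_div_distrib]
  simp only [Pi.div_apply]
  have : ∀ j : ℕ, 1 - κ * (t * θ) ^ 2 / (π ^ 2 * ((j : ℝ) + 1) ^ 2)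
      = 1 - t ^ 2 * (κ * θ ^ 2 / (π ^ 2 * ((j : ℝ) + 1) ^ 2)) := by
    intro j; ring
  simp only [this]
  field_simp

lemma sk_pos (κ θ : ℝ) (hθ : 0 < θ) (h : κ * θ ^ 2 < π ^ 2) : 0 < sk κ θ := by
  unfold sk
  split_ifs with h1 h2
  · have hs := Real.sqrt_pos.2 h1
    refine div_pos (Real.sin_pos_of_pos_of_lt_pi (by positivity) ?_) hs
    refine lt_of_pow_lt_pow_left₀ 2 Real.pi_pos.le ?_
    rwa [mul_pow, Real.sq_sqrt h1.le]
  · exact hθ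
  · have hk : 0 < -κ := by
      rcases lt_trichotomy κ 0 with h | h | h
      · linarith
      · exact absurd h h2
      · exact absurd h h1
    have hs := Real.sqrt_pos.2 hk
    exact div_pos (Real.sinh_pos_iff.2 (by positivity)) hs

lemma sg_pos (κ t θ : ℝ) (ht : 0 < t) (ht1 : t ≤ 1) (hθ : 0 < θ) (h : κ * θ ^ 2 < π ^ 2) :
    0 < sg κ t θ := by
  rw [sg, if_neg hθ.ne']
  refine div_pos (sk_pos _ _ (by positivity) ?_) (sk_pos _ _ hθ h)
  have e : κ * (t * θ) ^ 2 = t ^ 2 * (κ * θ ^ 2) := by ring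
  rw [e]
  have h2 : t ^ 2 ≤ 1 := pow_le_one₀ ht.le ht1
  have := Real.pi_pos
  have h3 : t ^ 2 * (κ * θ ^ 2) < t ^ 2 * π ^ 2 := mul_lt_mul_of_pos_left h (by positivity)
  nlinarith [sq_nonneg π]

lemma sg_le (κ l t θ : ℝ) (ht : 0 < t) (ht1 : t ≤ 1) (hθ : 0 < θ) (h : κ * θ ^ 2 < π ^ 2)
    (hl0 : 0 < l) (hl1 : l < 1) (h' : l * κ * θ ^ 2 < π ^ 2) :
    sg (l * κ) t θ / t ≤ (sg κ t θ / t) ^ l := by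
  have a := sg_tendsto (l * κ) t θ ht hθ (sk_pos _ _ hθ h').ne'
  have b := (sg_tendsto κ t θ ht hθ (sk_pos _ _ hθ h).ne').rpow_const (p := l) (Or.inr hl0.le)
  refine le_of_tendsto_of_tendsto' a b fun n => ?_
  have hpi := Real.pi_pos
  have ht2 : t ^ 2 ≤ 1 := pow_le_one₀ ht.le ht1
  have gen : ∀ k : ℝ, k * θ ^ 2 < π ^ 2 → ∀ j : ℕ,
      k * θ ^ 2 / (π ^ 2 * ((j : ℝ) + 1) ^ 2) < 1 := by
    intro k hk j
    rw [div_lt_one (by positivity)]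
    have : (1 : ℝ) ≤ ((j : ℝ) + 1) ^ 2 := one_le_pow₀ (by linarith [j.cast_nonneg (α := ℝ)])
    nlinarith [sq_nonneg π]
  have nn : ∀ k : ℝ, k * θ ^ 2 < π ^ 2 → ∀ j : ℕ,
      0 ≤ (1 - t ^ 2 * (k * θ ^ 2 / (π ^ 2 * ((j : ℝ) + 1) ^ 2))) /
        (1 - k * θ ^ 2 / (π ^ 2 * ((j : ℝ) + 1) ^ 2)) := by
    intro k hk j
    have := gen k hk j
    have h2 : 0 < t ^ 2 := by positivity
    refine div_nonneg ?_ (by linarith)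
    nlinarith
  rw [← Real.finsetProd_rpow _ _ (fun j _ => nn κ h j)]
  refine Finset.prod_le_prod (fun j _ => nn _ h' j) fun j _ => ?_
  have f := factor_le (t ^ 2) l _ (by positivity) ht2 hl0 hl1 (gen κ h j)
  have e : l * κ * θ ^ 2 / (π ^ 2 * ((j : ℝ) + 1) ^ 2)
      = l * (κ * θ ^ 2 / (π ^ 2 * ((j : ℝ) + 1) ^ 2)) := by ring
  rw [e]
  exact f

theorem stmt_18 (K N t θ : ℝ) (hN : N < 0) (ht : t ∈ Set.Ioc (0:ℝ) 1)
    (hθ : 0 < θ) (hθK : K < 0 → θ < π * Real.sqrt (N / K)) :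
    t ^ (1 / N) * (sg (K / (N - 1)) t θ) ^ ((N - 1) / N) ≤ sg (K / N) t θ ∧
    (sg (K / N) t θ) ^ N ≤ t * (sg (K / (N - 1)) t θ) ^ (N - 1) := by
  obtain ⟨ht0, ht1⟩ := ht
  have hN1 : N - 1 < 0 := by linarith
  have hpi := Real.pi_pos
  have h : K / N * θ ^ 2 < π ^ 2 := by
    rcases lt_or_ge K 0 with hK | hK
    · have h1 := pow_lt_pow_left₀ (hθK hK) hθ.le (n := 2) (by norm_num)
      rw [mul_pow, Real.sq_sqrt (div_pos_of_neg_of_neg hN hK).le] at h1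
      have h2 := mul_lt_mul_of_pos_left h1 (div_pos_of_neg_of_neg hK hN)
      refine h2.trans_eq ?_
      field_simp [hK.ne, hN.ne]
    · have : K / N ≤ 0 := div_nonpos_of_nonneg_of_nonpos hK hN.le
      nlinarith [sq_nonneg θ, pow_pos hpi 2]
  obtain ⟨l, hl⟩ : ∃ l, l = N / (N - 1) := ⟨_, rfl⟩
  have hl0 : 0 < l := hl ▸ div_pos_of_neg_of_neg hN hN1
  have hl1 : l < 1 := by rw [hl, div_lt_one_of_neg hN1]; linarith
  have hk : K / (N - 1) = l * (K / N) := by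
    rw [hl]; field_simp [hN.ne, hN1.ne]
  have h' : l * (K / N) * θ ^ 2 < π ^ 2 := by
    rw [mul_assoc]
    have := mul_lt_mul_of_pos_left h hl0
    nlinarith [sq_nonneg π]
  have hle := sg_le (K / N) l t θ ht0 ht1 hθ h hl0 hl1 h'
  have ha := sg_pos (K / N) t θ ht0 ht1 hθ h
  have hb := sg_pos (l * (K / N)) t θ ht0 ht1 hθ h'
  rw [hk]
  generalize sg (K / N) t θ = a at *
  generalize sg (l * (K / N)) t θ = b at *
  have hlog := Real.log_le_log (div_pos hb ht0) hle
  rw [Real.log_rpow (div_pos ha ht0), Real.log_div hb.ne' ht0.ne', Real.log_div ha.ne' ht0.ne',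
    hl, div_mul_eq_mul_div, le_div_iff_of_neg hN1] at hlog
  constructor
  · rw [← Real.log_le_log_iff (by positivity) ha, Real.log_mul (by positivity) (by positivity),
      Real.log_rpow ht0, Real.log_rpow hb]
    have : 1 / N * Real.log t + (N - 1) / N * Real.log b
      = (Real.log t + (N - 1) * Real.log b) / N := by ring
    rw [this, div_le_iff_of_neg hN]
    linarith
  · rw [← Real.log_le_log_iff (by positivity) (by positivity),
      Real.log_mul (by positivity) (by positivity), Real.log_rpow ha, Real.log_rpow hb]
    linarith
end
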